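/- Let ρ₁ = |ψ₁⟩⟨ψ₁| and ρ₂ = |ψ₂⟩⟨ψ₂| be pure-state density matrices on ℂ^n (rank-one projections onto unit vectors ψ₁, ψ₂), and let σ₁, σ₂ be density matrices on ℂ^m. Then there exists a quantum channel Λ from n×n to m×m complex matrices with Λ(ρ₁) = σ₁ and Λ(ρ₂) = σ₂ if and only if F(σ₁, σ₂) ≥ F(ρ₁, ρ₂) = |⟨ψ₁|ψ₂⟩|. -/

import Mathlib

open Matrix BigOperators ComplexOrder Classical

/-- The positive semidefinite square root of a matrix (junk value `0` if the
matrix is not positive semidefinite). -/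
noncomputable def matSqrt {n : ℕ} (A : Matrix (Fin n) (Fin n) ℂ) : Matrix (Fin n) (Fin n) ℂ :=
  if h : A.PosSemidef then
    h.1.eigenvectorUnitary.1 * diagonal ((↑) ∘ Real.sqrt ∘ h.1.eigenvalues) *
      (star h.1.eigenvectorUnitary : Matrix (Fin n) (Fin n) ℂ)
  else 0

/-- The fidelity `F(ρ, σ) = Tr √(√σ ρ √σ)` of two density matrices. -/
noncomputable def fidelity {n : ℕ} (ρ σ : Matrix (Fin n) (Fin n) ℂ) : ℝ :=
  ((matSqrt (matSqrt σ * ρ * matSqrt σ)).trace).re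

theorem matSqrt_posSemidef {n : ℕ} (A : Matrix (Fin n) (Fin n) ℂ) : (matSqrt A).PosSemidef := by
  unfold matSqrt
  split_ifs with h
  · refine PosSemidef.mul_mul_conjTranspose_same (PosSemidef.diagonal fun i => ?_) _
    simp [Real.sqrt_nonneg]
  · exact PosSemidef.zero

theorem matSqrt_mul_self {n : ℕ} {A : Matrix (Fin n) (Fin n) ℂ} (hA : A.PosSemidef) :
    matSqrt A * matSqrt A = A := by
  have hU : (star hA.1.eigenvectorUnitary : Matrix (Fin n) (Fin n) ℂ) *
      hA.1.eigenvectorUnitary.1 = 1 := Unitary.coe_star_mul_self _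
  have hD : diagonal ((↑) ∘ Real.sqrt ∘ hA.1.eigenvalues) *
      diagonal ((↑) ∘ Real.sqrt ∘ hA.1.eigenvalues) =
      diagonal ((↑) ∘ hA.1.eigenvalues : Fin n → ℂ) := by
    rw [diagonal_mul_diagonal]
    congr 1
    ext i
    simp [← Complex.ofReal_mul, Real.mul_self_sqrt (hA.eigenvalues_nonneg i)]
  conv_rhs => rw [hA.1.spectral_theorem, Unitary.conjStarAlgAut_apply]
  rw [matSqrt, dif_pos hA]
  calc _ = hA.1.eigenvectorUnitary.1 * diagonal ((↑) ∘ Real.sqrt ∘ hA.1.eigenvalues) *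
      ((star hA.1.eigenvectorUnitary : Matrix (Fin n) (Fin n) ℂ) *
      hA.1.eigenvectorUnitary.1) * diagonal ((↑) ∘ Real.sqrt ∘ hA.1.eigenvalues) *
      (star hA.1.eigenvectorUnitary : Matrix (Fin n) (Fin n) ℂ) := by
        simp only [Matrix.mul_assoc]
    _ = hA.1.eigenvectorUnitary.1 * (diagonal ((↑) ∘ Real.sqrt ∘ hA.1.eigenvalues) *
      diagonal ((↑) ∘ Real.sqrt ∘ hA.1.eigenvalues)) *
      (star hA.1.eigenvectorUnitary : Matrix (Fin n) (Fin n) ℂ) := by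
        rw [hU, Matrix.mul_one]; simp only [Matrix.mul_assoc]
    _ = _ := by rw [hD]; rfl

open scoped MatrixOrder in
theorem matSqrt_eq_of_mul_self {n : ℕ} {A B : Matrix (Fin n) (Fin n) ℂ} (hB : B.PosSemidef)
    (h : B * B = A) : matSqrt A = B := by
  have hA : A.PosSemidef := by
    rw [← h]
    nth_rewrite 1 [← hB.1.eq]
    exact posSemidef_conjTranspose_mul_self B
  rw [← CFC.sqrt_unique h hB.nonneg, CFC.sqrt_unique (matSqrt_mul_self hA)
    (matSqrt_posSemidef A).nonneg]

theorem Matrix.PosSemidef.one_sub_of_mul_self {m : Type*} [Fintype m] [DecidableEq m]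
    {P : Matrix m m ℂ} (hP : P.IsHermitian) (h : P * P = P) : (1 - P).PosSemidef := by
  have : (1 - P)ᴴ * (1 - P) = 1 - P := by
    simp [hP.eq, sub_mul, mul_sub, h]
  exact this ▸ posSemidef_conjTranspose_mul_self (1 - P)

/-- A Hermitian matrix has a Hermitian pseudo-inverse with which it commutes. -/
theorem Matrix.IsHermitian.exists_pseudoinverse {m : Type*} [Fintype m] [DecidableEq m]
    {S : Matrix m m ℂ} (hS : S.IsHermitian) :
    ∃ X : Matrix m m ℂ, X.IsHermitian ∧ S * X = X * S ∧ S * X * S = S ∧ X * S * X = X := by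
  obtain ⟨f, d, rfl⟩ : ∃ (f : Matrix m m ℂ ≃⋆ₐ[ℂ] Matrix m m ℂ) (d : m → ℝ),
      S = f (diagonal ((↑) ∘ d : m → ℂ)) := ⟨_, _, hS.spectral_theorem⟩
  refine ⟨f (diagonal ((↑) ∘ (fun i => (d i)⁻¹) : m → ℂ)), ?_, ?_, ?_, ?_⟩
  · rw [Matrix.IsHermitian, ← star_eq_conjTranspose, ← map_star, star_eq_conjTranspose,
      diagonal_conjTranspose]
    congr 2
    ext i
    simp
  all_goals
    simp only [← map_mul, diagonal_mul_diagonal]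
    congr 2
    ext i
    by_cases h : (d i : ℂ) = 0 <;> simp [h]

/-- Douglas factorization: if `Φ Φᴴ = S²` then `Φ = S W` with `W` a partial isometry onto the
support of `S`. -/
theorem Matrix.IsHermitian.exists_factor {m ι : Type*} [Fintype m] [DecidableEq m] [Fintype ι]
    {S : Matrix m m ℂ} (hS : S.IsHermitian) {Φ : Matrix m ι ℂ} (h : Φ * Φᴴ = S * S) :
    ∃ W : Matrix m ι ℂ, Φ = S * W ∧ S * (W * Wᴴ) = S ∧ (W * Wᴴ) * (W * Wᴴ) = W * Wᴴ := by
  obtain ⟨X, hX, hc, h1, h2⟩ := hS.exists_pseudoinverse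
  have hW : (X * Φ) * (X * Φ)ᴴ = X * S := by
    calc (X * Φ) * (X * Φ)ᴴ = X * (Φ * Φᴴ) * X := by
          rw [conjTranspose_mul, hX.eq]; simp only [Matrix.mul_assoc]
      _ = (X * S) * (S * X) := by rw [h]; simp only [Matrix.mul_assoc]
      _ = (X * S * X) * S := by rw [hc]; simp only [Matrix.mul_assoc]
      _ = X * S := by rw [h2]
  refine ⟨X * Φ, ?_, ?_, ?_⟩
  · have h3 : (Φ - S * (X * Φ)) * (Φ - S * (X * Φ))ᴴ = 0 := by
      have h4 : Φ - S * (X * Φ) = (1 - S * X) * Φ := by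
        rw [Matrix.sub_mul, Matrix.one_mul, Matrix.mul_assoc]
      have h5 : (1 - S * X) * S = 0 := by rw [sub_mul, h1, Matrix.one_mul, sub_self]
      rw [h4, conjTranspose_mul, Matrix.mul_assoc, ← Matrix.mul_assoc Φ, h, Matrix.mul_assoc S,
        ← Matrix.mul_assoc, h5, Matrix.zero_mul]
    rw [self_mul_conjTranspose_eq_zero] at h3
    exact sub_eq_zero.mp h3
  · rw [hW, ← Matrix.mul_assoc, h1]
  · rw [hW, ← Matrix.mul_assoc, h2]

/-- The polar-type decomposition underlying the fidelity. -/
theorem exists_polar_fidelity {m : ℕ} {σ₁ σ₂ : Matrix (Fin m) (Fin m) ℂ}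
    (h₁ : σ₁.PosSemidef) :
    ∃ T W : Matrix (Fin m) (Fin m) ℂ, T.PosSemidef ∧ T.trace = fidelity σ₁ σ₂ ∧
      matSqrt σ₁ * matSqrt σ₂ = Wᴴ * T ∧ T * (W * Wᴴ) = T ∧
      (W * Wᴴ) * (W * Wᴴ) = W * Wᴴ := by
  have hS₁ := (matSqrt_posSemidef σ₁).1
  have hS₂ := (matSqrt_posSemidef σ₂).1
  have hP : (matSqrt σ₂ * σ₁ * matSqrt σ₂).PosSemidef := by
    simpa [hS₂.eq] using h₁.mul_mul_conjTranspose_same (matSqrt σ₂)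
  set T := matSqrt (matSqrt σ₂ * σ₁ * matSqrt σ₂) with hT
  have hTp : T.PosSemidef := matSqrt_posSemidef _
  have h : (matSqrt σ₂ * matSqrt σ₁) * (matSqrt σ₂ * matSqrt σ₁)ᴴ = T * T := by
    rw [hT, matSqrt_mul_self hP, conjTranspose_mul, hS₁.eq, hS₂.eq, Matrix.mul_assoc,
      ← Matrix.mul_assoc (matSqrt σ₁), matSqrt_mul_self h₁, Matrix.mul_assoc]
  obtain ⟨W, hW, h1, h2⟩ := hTp.1.exists_factor h
  refine ⟨T, W, hTp, ?_, ?_, h1, h2⟩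
  · have him := (Complex.nonneg_iff.mp hTp.trace_nonneg).2
    exact Complex.ext (by simp [fidelity, hT]) (by simpa using him.symm)
  · have := congrArg conjTranspose hW
    simpa [conjTranspose_mul, hS₁.eq, hS₂.eq, hTp.1.eq] using this

theorem norm_trace_conjTranspose_mul_le {m ι : Type*} [Fintype m] [Fintype ι]
    (X Y : Matrix m ι ℂ) :
    ‖(Xᴴ * Y).trace‖ ≤ ((X * Xᴴ).trace.re + (Y * Yᴴ).trace.re) / 2 := by
  have h (Z : Matrix m ι ℂ) : (Z * Zᴴ).trace.re = ∑ j, ∑ i, ‖Z i j‖ ^ 2 := by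
    rw [trace_mul_comm]
    simp [trace, mul_apply, Complex.conj_mul', ← Complex.ofReal_pow]
  rw [h, h, ← Finset.sum_add_distrib, Finset.sum_div]
  refine (norm_sum_le _ _).trans (Finset.sum_le_sum fun j _ => ?_)
  rw [← Finset.sum_add_distrib, Finset.sum_div, diag_apply, mul_apply]
  refine (norm_sum_le _ _).trans (Finset.sum_le_sum fun i _ => ?_)
  rw [conjTranspose_apply, norm_mul, norm_star]
  nlinarith [sq_nonneg (‖X i j‖ - ‖Y i j‖)]

/-- Sandwiching a contraction in a positive matrix does not increase the trace. -/
theorem Matrix.IsHermitian.re_trace_conj_le {m : Type*} [Fintype m] [DecidableEq m]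
    {R P : Matrix m m ℂ} (hR : R.IsHermitian) (hP : (1 - P).PosSemidef) :
    (R * P * R).trace.re ≤ (R * R).trace.re := by
  have h := (hP.mul_mul_conjTranspose_same R).trace_nonneg
  rw [hR.eq, Matrix.mul_sub, Matrix.sub_mul, Matrix.mul_one, trace_sub] at h
  simpa using (Complex.nonneg_iff.mp h).1

/-- The overlap of any two purifications is bounded by the fidelity. -/
theorem norm_trace_le_fidelity {m : ℕ} {ι : Type*} [Fintype ι]
    {σ₁ σ₂ : Matrix (Fin m) (Fin m) ℂ} (h₁ : σ₁.PosSemidef) (h₂ : σ₂.PosSemidef)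
    {Φ₁ Φ₂ : Matrix (Fin m) ι ℂ} (hΦ₁ : Φ₁ * Φ₁ᴴ = σ₁) (hΦ₂ : Φ₂ * Φ₂ᴴ = σ₂) :
    ‖(Φ₁ᴴ * Φ₂).trace‖ ≤ fidelity σ₁ σ₂ := by
  obtain ⟨T, W, hT, hTr, hM, h1, h2⟩ := exists_polar_fidelity (σ₂ := σ₂) h₁
  have hS₁ := (matSqrt_posSemidef σ₁).1
  have hS₂ := (matSqrt_posSemidef σ₂).1
  obtain ⟨W₁, hW₁, -, hi₁⟩ := hS₁.exists_factor (hΦ₁.trans (matSqrt_mul_self h₁).symm)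
  obtain ⟨W₂, hW₂, -, hi₂⟩ := hS₂.exists_factor (hΦ₂.trans (matSqrt_mul_self h₂).symm)
  have hp (V : Matrix (Fin m) ι ℂ) (h : V * Vᴴ * (V * Vᴴ) = V * Vᴴ) : (1 - V * Vᴴ).PosSemidef :=
    .one_sub_of_mul_self (posSemidef_self_mul_conjTranspose V).1 h
  have hW : (1 - W * Wᴴ).PosSemidef :=
    .one_sub_of_mul_self (posSemidef_self_mul_conjTranspose W).1 h2
  have hc : (1 - W * (W₁ * W₁ᴴ) * Wᴴ).PosSemidef := by
    have := hW.add ((hp W₁ hi₁).mul_mul_conjTranspose_same W)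
    rw [Matrix.mul_sub, Matrix.sub_mul, Matrix.mul_one] at this
    simpa using this
  set R := matSqrt T
  have hR : R.IsHermitian := (matSqrt_posSemidef T).1
  have hRR : R * R = T := matSqrt_mul_self hT
  have key : Φ₁ᴴ * Φ₂ = (R * (W * W₁))ᴴ * (R * W₂) := by
    calc Φ₁ᴴ * Φ₂ = W₁ᴴ * (matSqrt σ₁ * matSqrt σ₂) * W₂ := by
          rw [hW₁, hW₂, conjTranspose_mul, hS₁.eq]; simp only [Matrix.mul_assoc]
      _ = W₁ᴴ * (Wᴴ * (R * R)) * W₂ := by rw [hM, hRR]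
      _ = _ := by rw [conjTranspose_mul, conjTranspose_mul, hR.eq]; simp only [Matrix.mul_assoc]
  have e1 : (R * (W * W₁)) * (R * (W * W₁))ᴴ = R * (W * (W₁ * W₁ᴴ) * Wᴴ) * R := by
    rw [conjTranspose_mul, conjTranspose_mul, hR.eq]; simp only [Matrix.mul_assoc]
  have e2 : (R * W₂) * (R * W₂)ᴴ = R * (W₂ * W₂ᴴ) * R := by
    rw [conjTranspose_mul, hR.eq]; simp only [Matrix.mul_assoc]
  have b := norm_trace_conjTranspose_mul_le (R * (W * W₁)) (R * W₂)
  rw [← key, e1, e2] at b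
  have b1 := hR.re_trace_conj_le hc
  have b2 := hR.re_trace_conj_le (hp W₂ hi₂)
  rw [hRR, hTr, Complex.ofReal_re] at b1 b2
  linarith

/-- Every overlap allowed by the fidelity is attained by some pair of purifications. -/
theorem exists_purifications {m : ℕ} {σ₁ σ₂ : Matrix (Fin m) (Fin m) ℂ}
    (h₁ : σ₁.PosSemidef) (h₂ : σ₂.PosSemidef) {c : ℂ} (hc : ‖c‖ ≤ fidelity σ₁ σ₂) :
    ∃ Φ₁ Φ₂ : Matrix (Fin m) (Fin m ⊕ Fin m) ℂ,
      Φ₁ * Φ₁ᴴ = σ₁ ∧ Φ₂ * Φ₂ᴴ = σ₂ ∧ (Φ₁ᴴ * Φ₂).trace = c := by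
  obtain ⟨T, W, hT, hTr, hM, h1, h2⟩ := exists_polar_fidelity (σ₂ := σ₂) h₁
  have hS₁ := (matSqrt_posSemidef σ₁).1
  have hS₂ := (matSqrt_posSemidef σ₂).1
  obtain ⟨z, hz, hzc⟩ : ∃ z : ℂ, ‖z‖ ≤ 1 ∧ z * fidelity σ₁ σ₂ = c := by
    by_cases hf : fidelity σ₁ σ₂ = 0
    · refine ⟨0, by simp, ?_⟩
      rw [hf, norm_le_zero_iff] at hc
      simp [hc]
    · refine ⟨c / fidelity σ₁ σ₂, ?_, div_mul_cancel₀ _ (by exact_mod_cast hf)⟩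
      rw [norm_div, Complex.norm_real, Real.norm_eq_abs]
      exact div_le_one_of_le₀ (hc.trans (le_abs_self _)) (abs_nonneg _)
  have hD : (1 - (z • W) * (z • W)ᴴ).PosSemidef := by
    have hW : (1 - W * Wᴴ).PosSemidef :=
      .one_sub_of_mul_self (posSemidef_self_mul_conjTranspose W).1 h2
    have hs : (0 : ℂ) ≤ ((1 - ‖z‖ ^ 2 : ℝ) : ℂ) := by
      rw [Complex.zero_le_real]
      nlinarith [norm_nonneg z]
    have := hW.add ((posSemidef_self_mul_conjTranspose W).smul hs)
    convert this using 1
    rw [conjTranspose_smul, Matrix.smul_mul, Matrix.mul_smul, smul_smul, Complex.star_def,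
      Complex.mul_conj']
    push_cast
    module
  set D := matSqrt (1 - (z • W) * (z • W)ᴴ)
  have hDh : D.IsHermitian := (matSqrt_posSemidef _).1
  have hDD : D * D = 1 - (z • W) * (z • W)ᴴ := matSqrt_mul_self hD
  refine ⟨fromCols (matSqrt σ₁) 0, fromCols (matSqrt σ₂ * (z • W)) (matSqrt σ₂ * D), ?_, ?_, ?_⟩
  · rw [conjTranspose_fromCols_eq_fromRows_conjTranspose, fromCols_mul_fromRows]
    simp [hS₁.eq, matSqrt_mul_self h₁]
  · rw [conjTranspose_fromCols_eq_fromRows_conjTranspose, fromCols_mul_fromRows]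
    calc _ = matSqrt σ₂ * ((z • W) * (z • W)ᴴ + D * D) * matSqrt σ₂ := by
          rw [conjTranspose_mul, conjTranspose_mul, hS₂.eq, hDh.eq, Matrix.mul_add, Matrix.add_mul]
          simp only [Matrix.mul_assoc]
      _ = σ₂ := by rw [hDD, add_sub_cancel, Matrix.mul_one, matSqrt_mul_self h₂]
  · rw [trace_mul_comm, conjTranspose_fromCols_eq_fromRows_conjTranspose, fromCols_mul_fromRows,
      conjTranspose_zero, Matrix.mul_zero, add_zero, hS₁.eq, trace_mul_comm, ← Matrix.mul_assoc,
      hM, Matrix.mul_smul, trace_smul, trace_mul_comm, ← Matrix.mul_assoc, trace_mul_comm, h1, hTr,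
      smul_eq_mul, hzc]

theorem fidelity_vecMulVec_star {n : ℕ} (ψ₁ ψ₂ : Fin n → ℂ) (h₂ : star ψ₂ ⬝ᵥ ψ₂ = 1) :
    fidelity (vecMulVec ψ₁ (star ψ₁)) (vecMulVec ψ₂ (star ψ₂)) = ‖star ψ₁ ⬝ᵥ ψ₂‖ := by
  have hs : matSqrt (vecMulVec ψ₂ (star ψ₂)) = vecMulVec ψ₂ (star ψ₂) :=
    matSqrt_eq_of_mul_self (posSemidef_vecMulVec_self_star ψ₂) (by
      rw [vecMulVec_mul_vecMulVec, h₂, one_smul])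
  have hc : star ψ₂ ⬝ᵥ ψ₁ = star (star ψ₁ ⬝ᵥ ψ₂) := by
    rw [star_dotProduct]
  have h : matSqrt (vecMulVec ψ₂ (star ψ₂) * vecMulVec ψ₁ (star ψ₁) * vecMulVec ψ₂ (star ψ₂)) =
      (‖star ψ₁ ⬝ᵥ ψ₂‖ : ℂ) • vecMulVec ψ₂ (star ψ₂) := by
    refine matSqrt_eq_of_mul_self ((posSemidef_vecMulVec_self_star ψ₂).smul (by simp)) ?_
    rw [Matrix.smul_mul, Matrix.mul_smul, smul_smul]
    simp only [vecMulVec_mul_vecMulVec, h₂, one_smul, hc, vecMulVec_smul, Matrix.smul_mul,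
      smul_smul]
    rw [← sq, ← Complex.conj_mul']
    rfl
  rw [fidelity, hs, h, trace_smul, trace_vecMulVec, dotProduct_comm ψ₂, h₂]
  simp

theorem inv_mul_self_smul_of_dotProduct {l : Type*} [Fintype l] {v : l → ℂ} {d : ℂ}
    (hv : star v ⬝ᵥ v = d) : (d⁻¹ * d) • v = v := by
  by_cases h : d = 0
  · rw [h, dotProduct_star_self_eq_zero] at hv
    simp [hv]
  · simp [h]

/-- Two pairs of vectors with the same Gram matrix are related by a partial isometry. -/
theorem exists_partialIsometry {m n : Type*} [Fintype m] [Fintype n]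
    {ψ₁ ψ₂ : n → ℂ} {φ₁ φ₂ : m → ℂ}
    (h₁ : star ψ₁ ⬝ᵥ ψ₁ = 1) (h₁' : star φ₁ ⬝ᵥ φ₁ = 1)
    (h₂ : star ψ₂ ⬝ᵥ ψ₂ = star φ₂ ⬝ᵥ φ₂) (h₁₂ : star ψ₁ ⬝ᵥ ψ₂ = star φ₁ ⬝ᵥ φ₂) :
    ∃ V : Matrix m n ℂ, V *ᵥ ψ₁ = φ₁ ∧ V *ᵥ ψ₂ = φ₂ ∧
      Vᴴ *ᵥ φ₁ = ψ₁ ∧ Vᴴ *ᵥ φ₂ = ψ₂ ∧ (Vᴴ * V) * (Vᴴ * V) = Vᴴ * V := by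
  obtain ⟨a, ha⟩ : ∃ a, star ψ₁ ⬝ᵥ ψ₂ = a := ⟨_, rfl⟩
  have ha' : star φ₁ ⬝ᵥ φ₂ = a := h₁₂ ▸ ha
  have hs : star ψ₂ ⬝ᵥ ψ₁ = star a := by rw [← ha, star_dotProduct]
  have hs' : star φ₂ ⬝ᵥ φ₁ = star a := by rw [← ha', star_dotProduct]
  obtain ⟨η, hη⟩ : ∃ η, ψ₂ = a • ψ₁ + η := ⟨ψ₂ - a • ψ₁, by simp⟩
  obtain ⟨χ, hχ⟩ : ∃ χ, φ₂ = a • φ₁ + χ := ⟨φ₂ - a • φ₁, by simp⟩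
  have o1 : star ψ₁ ⬝ᵥ η = 0 := by simpa [hη, dotProduct_add, h₁] using ha
  have o1' : star φ₁ ⬝ᵥ χ = 0 := by simpa [hχ, dotProduct_add, h₁'] using ha'
  have o2 : star η ⬝ᵥ ψ₁ = 0 := by simpa [hη, add_dotProduct, h₁] using hs
  have o2' : star χ ⬝ᵥ φ₁ = 0 := by simpa [hχ, add_dotProduct, h₁'] using hs'
  obtain ⟨d, hd⟩ : ∃ d, star η ⬝ᵥ η = d := ⟨_, rfl⟩
  have hd' : star χ ⬝ᵥ χ = d := by
    rw [hη, hχ] at h₂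
    simpa [dotProduct_add, add_dotProduct, h₁, h₁', o1, o1', o2, o2', hd, eq_comm] using h₂
  have hds : star d = d := by rw [← hd]; exact (star_dotProduct η η).symm
  have e := inv_mul_self_smul_of_dotProduct hd
  have e' := inv_mul_self_smul_of_dotProduct hd'
  have hV : ((vecMulVec φ₁ (star ψ₁) + d⁻¹ • vecMulVec χ (star η))ᴴ : Matrix n m ℂ) =
      vecMulVec ψ₁ (star φ₁) + d⁻¹ • vecMulVec η (star χ) := by
    simp only [conjTranspose_add, conjTranspose_smul, conjTranspose_vecMulVec, star_star, star_inv₀,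
      hds]
  have c1 : (vecMulVec φ₁ (star ψ₁) + d⁻¹ • vecMulVec χ (star η)) *ᵥ ψ₁ = φ₁ := by
    simp [add_mulVec, smul_mulVec, vecMulVec_mulVec, h₁, o2]
  have c2 : (vecMulVec φ₁ (star ψ₁) + d⁻¹ • vecMulVec χ (star η)) *ᵥ η = χ := by
    simp [add_mulVec, smul_mulVec, vecMulVec_mulVec, o1, hd, smul_smul, e']
  have c1' : (vecMulVec ψ₁ (star φ₁) + d⁻¹ • vecMulVec η (star χ)) *ᵥ φ₁ = ψ₁ := by
    simp [add_mulVec, smul_mulVec, vecMulVec_mulVec, h₁', o2']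
  have c2' : (vecMulVec ψ₁ (star φ₁) + d⁻¹ • vecMulVec η (star χ)) *ᵥ χ = η := by
    simp [add_mulVec, smul_mulVec, vecMulVec_mulVec, o1', hd', smul_smul, e]
  refine ⟨vecMulVec φ₁ (star ψ₁) + d⁻¹ • vecMulVec χ (star η), c1, ?_, ?_, ?_, ?_⟩
  · rw [hη, mulVec_add, mulVec_smul, c1, c2, hχ]
  · rw [hV, c1']
  · rw [hV, hη, hχ, mulVec_add, mulVec_smul, c1', c2']
  · have hP : (vecMulVec ψ₁ (star φ₁) + d⁻¹ • vecMulVec η (star χ)) *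
        (vecMulVec φ₁ (star ψ₁) + d⁻¹ • vecMulVec χ (star η)) =
        vecMulVec ψ₁ (star ψ₁) + d⁻¹ • vecMulVec η (star η) := by
      rw [Matrix.mul_add, mul_vecMulVec, c1', Matrix.mul_smul, mul_vecMulVec, c2']
    rw [hV, hP, Matrix.mul_add, mul_vecMulVec, Matrix.mul_smul, mul_vecMulVec, ← hP,
      ← mulVec_mulVec, ← mulVec_mulVec, c1, c1', c2, c2', hP]

theorem vecMulVec_star_conj {m n : Type*} [Fintype n] (K : Matrix m n ℂ) (ψ : n → ℂ) :
    K * vecMulVec ψ (star ψ) * Kᴴ = vecMulVec (K *ᵥ ψ) (star (K *ᵥ ψ)) := by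
  rw [mul_vecMulVec, vecMulVec_mul, star_mulVec]

theorem sum_vecMulVec_col {m ι : Type*} [Fintype ι] (Φ : Matrix m ι ℂ) :
    ∑ k, vecMulVec (Φ.col k) (star (Φ.col k)) = Φ * Φᴴ := by
  ext i j
  simp [Matrix.sum_apply, mul_apply, vecMulVec_apply]

theorem dotProduct_uncurry_eq_trace {m ι : Type*} [Fintype m] [Fintype ι] (Φ₁ Φ₂ : Matrix m ι ℂ) :
    star (fun p : m × ι => Φ₁ p.1 p.2) ⬝ᵥ (fun p => Φ₂ p.1 p.2) = (Φ₁ᴴ * Φ₂).trace := by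
  simp only [dotProduct, trace, diag_apply, mul_apply, Fintype.sum_prod_type, conjTranspose_apply,
    Pi.star_apply]
  exact Finset.sum_comm

/-- A partial isometry into a dilated space, completed to a channel. -/
theorem exists_kraus {m n ι : Type*} [Fintype m] [DecidableEq m] [Nonempty m] [Fintype n]
    [DecidableEq n] [Fintype ι] {V : Matrix (m × ι) n ℂ}
    (hV : (Vᴴ * V) * (Vᴴ * V) = Vᴴ * V) :
    ∃ (N : ℕ) (K : Fin N → Matrix m n ℂ), ∑ k, (K k)ᴴ * K k = 1 ∧
      ∀ (ψ : n → ℂ) (Φ : Matrix m ι ℂ), V *ᵥ ψ = (fun p => Φ p.1 p.2) →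
        Vᴴ *ᵥ (fun p => Φ p.1 p.2) = ψ →
        ∑ k, K k * vecMulVec ψ (star ψ) * (K k)ᴴ = Φ * Φᴴ := by
  obtain ⟨i₀⟩ := ‹Nonempty m›
  set R : Matrix n n ℂ := 1 - Vᴴ * V with hR
  have hRh : Rᴴ = R := by simp [hR]
  have hRR : R * R = R := by simp [hR, sub_mul, mul_sub, hV]
  let K : ι ⊕ n → Matrix m n ℂ := Sum.elim (fun k => of fun i j => V (i, k) j)
    (fun k => vecMulVec (Pi.single i₀ 1) (R k))
  have hK1 : ∑ k, (K k)ᴴ * K k = 1 := by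
    have t1 : ∑ k, (K (.inl k))ᴴ * K (.inl k) = Vᴴ * V := by
      ext i j
      simp only [K, Sum.elim_inl, Matrix.sum_apply, mul_apply, conjTranspose_apply, of_apply,
        Fintype.sum_prod_type]
      exact Finset.sum_comm
    have t2 : ∑ k, (K (.inr k))ᴴ * K (.inr k) = Rᴴ * R := by
      ext i j
      simp [K, Matrix.sum_apply, mul_apply, vecMulVec_apply, Pi.single_apply]
    rw [Fintype.sum_sum_type, t1, t2, hRh, hRR, hR, add_sub_cancel]
  have hK2 (ψ : n → ℂ) (Φ : Matrix m ι ℂ) (h : V *ᵥ ψ = (fun p => Φ p.1 p.2))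
      (h' : Vᴴ *ᵥ (fun p => Φ p.1 p.2) = ψ) :
      ∑ k, K k * vecMulVec ψ (star ψ) * (K k)ᴴ = Φ * Φᴴ := by
    have t1 (k : ι) : K (.inl k) *ᵥ ψ = Φ.col k := by
      ext i
      exact congrFun h (i, k)
    have hRψ : R *ᵥ ψ = 0 := by
      rw [hR, sub_mulVec, one_mulVec, ← mulVec_mulVec, h, h', sub_self]
    have t2 (k : n) : K (.inr k) *ᵥ ψ = 0 := by
      have : R k ⬝ᵥ ψ = 0 := congrFun hRψ k
      simp [K, vecMulVec_mulVec, this]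
    simp [vecMulVec_star_conj, t1, t2, sum_vecMulVec_col]
  let e := Fintype.equivFin (ι ⊕ n)
  refine ⟨Fintype.card (ι ⊕ n), fun k => K (e.symm k), ?_, fun ψ Φ h h' => ?_⟩
  · rw [← hK1]
    exact Equiv.sum_comp e.symm fun k => (K k)ᴴ * K k
  · rw [← hK2 ψ Φ h h']
    exact Equiv.sum_comp e.symm fun k => K k * vecMulVec ψ (star ψ) * (K k)ᴴ

/-- For pure input states `ρᵢ = |ψᵢ⟩⟨ψᵢ|` and density matrices `σ₁, σ₂`, a quantum
channel mapping `ρᵢ ↦ σᵢ` exists iff `F(σ₁, σ₂) ≥ F(ρ₁, ρ₂) = |⟨ψ₁|ψ₂⟩|`. -/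
theorem channel_exists_iff_fidelity_pure
    {n m : ℕ}
    (ψ₁ ψ₂ : Fin n → ℂ)
    (hψ₁ : ∑ i, ‖ψ₁ i‖ ^ 2 = 1) (hψ₂ : ∑ i, ‖ψ₂ i‖ ^ 2 = 1)
    (σ₁ σ₂ : Matrix (Fin m) (Fin m) ℂ)
    (hσ₁ : σ₁.PosSemidef) (hσ₁1 : σ₁.trace = 1)
    (hσ₂ : σ₂.PosSemidef) (hσ₂1 : σ₂.trace = 1) :
    fidelity (vecMulVec ψ₁ (star ψ₁)) (vecMulVec ψ₂ (star ψ₂))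
        = ‖∑ i, (starRingEnd ℂ) (ψ₁ i) * ψ₂ i‖ ∧
    ((∃ (N : ℕ) (K : Fin N → Matrix (Fin m) (Fin n) ℂ),
        (∑ k, (K k)ᴴ * K k = 1) ∧
        (∑ k, K k * vecMulVec ψ₁ (star ψ₁) * (K k)ᴴ = σ₁) ∧
        (∑ k, K k * vecMulVec ψ₂ (star ψ₂) * (K k)ᴴ = σ₂)) ↔
      fidelity σ₁ σ₂ ≥ ‖∑ i, (starRingEnd ℂ) (ψ₁ i) * ψ₂ i‖) := by
  have hn (ψ : Fin n → ℂ) (h : ∑ i, ‖ψ i‖ ^ 2 = 1) : star ψ ⬝ᵥ ψ = 1 := by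
    simp only [dotProduct, Pi.star_apply, Complex.star_def, Complex.conj_mul']
    exact_mod_cast h
  have h₁ := hn ψ₁ hψ₁
  have h₂ := hn ψ₂ hψ₂
  have hin : ∑ i, (starRingEnd ℂ) (ψ₁ i) * ψ₂ i = star ψ₁ ⬝ᵥ ψ₂ := rfl
  rw [hin]
  refine ⟨fidelity_vecMulVec_star ψ₁ ψ₂ h₂, ?_, fun hf => ?_⟩
  · rintro ⟨N, K, hK, hK₁, hK₂⟩
    have hΦ (ψ : Fin n → ℂ) : (of fun i k => (K k *ᵥ ψ) i) * (of fun i k => (K k *ᵥ ψ) i)ᴴ =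
        ∑ k, K k * vecMulVec ψ (star ψ) * (K k)ᴴ := by
      simp only [vecMulVec_star_conj, ← sum_vecMulVec_col]
      rfl
    have h := norm_trace_le_fidelity hσ₁ hσ₂ ((hΦ ψ₁).trans hK₁) ((hΦ ψ₂).trans hK₂)
    convert h using 2
    calc star ψ₁ ⬝ᵥ ψ₂ = star ψ₁ ⬝ᵥ ((∑ k, (K k)ᴴ * K k) *ᵥ ψ₂) := by rw [hK, one_mulVec]
      _ = ∑ k, star (K k *ᵥ ψ₁) ⬝ᵥ (K k *ᵥ ψ₂) := by
        simp only [sum_mulVec, dotProduct_sum, ← mulVec_mulVec, star_mulVec, dotProduct_mulVec]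
      _ = _ := by simp [trace, mul_apply, dotProduct]
  · have : Nonempty (Fin m) := by
      by_contra h
      rw [not_nonempty_iff] at h
      simp [trace] at hσ₁1
    obtain ⟨Φ₁, Φ₂, hΦ₁, hΦ₂, hc⟩ := exists_purifications hσ₁ hσ₂ hf
    obtain ⟨V, hV₁, hV₂, hV₁', hV₂', hV⟩ := exists_partialIsometry
      (φ₁ := fun p : Fin m × (Fin m ⊕ Fin m) => Φ₁ p.1 p.2) (φ₂ := fun p => Φ₂ p.1 p.2) h₁
      (by rw [dotProduct_uncurry_eq_trace, trace_mul_comm, hΦ₁, hσ₁1])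
      (by rw [dotProduct_uncurry_eq_trace, trace_mul_comm, hΦ₂, hσ₂1, h₂])
      (by rw [dotProduct_uncurry_eq_trace, hc])
    obtain ⟨N, K, hK, h⟩ := exists_kraus hV
    exact ⟨N, K, hK, (h ψ₁ Φ₁ hV₁ hV₁').trans hΦ₁, (h ψ₂ Φ₂ hV₂ hV₂').trans hΦ₂⟩
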